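/- arXiv:2103.01391 — 4 statements merged into one kernel-verified Lean document; each statement's English description precedes it below -/
import Mathlib

section
/- For any Q ∈ L²(π), ∫_X ∫_X (r(x) + γQ(x′) − Q(x)) (Q(x) − V(x)) P(x, dx′) π(dx) ≤ −(1−γ) ‖Q − V‖²_π. (Proposition 1, part (1).) -/
open MeasureTheory ProbabilityTheory Finset
open scoped ENNReal

noncomputable section

/-- Dot product on `Fin d → ℝ`. -/
def dotp {d : ℕ} (w x : Fin d → ℝ) : ℝ := ∑ j, w j * x j

/-- Euclidean norm on `Fin d → ℝ`. -/
def vnorm {d : ℕ} (w : Fin d → ℝ) : ℝ := Real.sqrt (∑ j, w j ^ 2)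

/-- Standard Gaussian `N(0, I_d)` on `Fin d → ℝ`. -/
def stdGaussian (d : ℕ) : Measure (Fin d → ℝ) := Measure.pi fun _ => gaussianReal 0 1

/-- Uniform distribution on `{-1, +1} ⊆ ℝ`. -/
def pmOne : Measure ℝ := (2 : ℝ≥0∞)⁻¹ • Measure.dirac 1 + (2 : ℝ≥0∞)⁻¹ • Measure.dirac (-1)

/-- Two-layer ReLU network `Q(x; W, a)` of width `m`. -/
def netQ {d : ℕ} (m : ℕ) (x : Fin d → ℝ) (W : ℕ → Fin d → ℝ) (a : ℕ → ℝ) : ℝ :=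
  (Real.sqrt m)⁻¹ * ∑ i ∈ Finset.range m, a i * max (dotp (W i) x) 0

/-- The pairing `∇_W Q(x; W, a)ᵀ U = (1/√m) Σ_i a_i 1{W_iᵀx ≥ 0} U_iᵀ x`. -/
def gradDot {d : ℕ} (m : ℕ) (x : Fin d → ℝ) (W U : ℕ → Fin d → ℝ) (a : ℕ → ℝ) : ℝ :=
  (Real.sqrt m)⁻¹ * ∑ i ∈ Finset.range m,
    a i * (if 0 ≤ dotp (W i) x then dotp (U i) x else 0)

/-- `‖f‖_π = (∫ f² dπ)^{1/2}`. -/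
def pnorm {X : Type*} [MeasurableSpace X] (π : Measure X) (f : X → ℝ) : ℝ :=
  Real.sqrt (∫ x, f x ^ 2 ∂π)

/-- `ℓ(m, δ) = 4√(d log(2m+1)) + 4√(log(1/δ))`. -/
def ellBound (d m : ℕ) (δ : ℝ) : ℝ :=
  4 * Real.sqrt (d * Real.log (2 * m + 1)) + 4 * Real.sqrt (Real.log (1 / δ))

/-- The reference point `W̄ = (W_i(0) + a_i v(W_i(0)) / √m)_i`. -/
def WbarDef {d : ℕ} (m : ℕ) (a : ℕ → ℝ) (W0 : ℕ → Fin d → ℝ)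
    (v : (Fin d → ℝ) → Fin d → ℝ) : ℕ → Fin d → ℝ :=
  fun i j => W0 i j + a i * v (W0 i) j / Real.sqrt m

/-- Squared Euclidean norm of the concatenation, `‖W - W'‖₂²`. -/
def diffSq {d : ℕ} (m : ℕ) (W W' : ℕ → Fin d → ℝ) : ℝ :=
  ∑ i ∈ Finset.range m, ∑ j, (W i j - W' i j) ^ 2

/-- The event `{t < t₁}`: all iterates up to time `t` stay within `λ/√m` of initialization. -/
def inBallUpTo {d : ℕ} (m : ℕ) (lam : ℝ) (W : ℕ → ℕ → Fin d → ℝ)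
    (W0 : ℕ → Fin d → ℝ) (t : ℕ) : Prop :=
  ∀ s ≤ t, ∀ i < m, vnorm (fun j => W s i j - W0 i j) ≤ lam / Real.sqrt m

/-- The event `E₁`. -/
def E1ev {d : ℕ} (m : ℕ) (lam ℓ : ℝ) (Xs : Set (Fin d → ℝ)) (W0 : ℕ → Fin d → ℝ) : Prop :=
  ∀ x ∈ Xs, (m : ℝ)⁻¹ * ∑ i ∈ Finset.range m,
      (if |dotp (W0 i) x| ≤ lam / Real.sqrt m then (1 : ℝ) else 0)
    ≤ (lam + ℓ) / Real.sqrt m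

/-- **Proposition 1, part (1)**. -/
theorem prop1_part1
    {d : ℕ} {γ : ℝ} (hγ : γ ∈ Set.Ioo (0:ℝ) 1)
    (Xs : Set (Fin d → ℝ)) (hXs : MeasurableSet Xs)
    (hXball : ∀ x ∈ Xs, vnorm x ≤ 1)
    (P : Kernel Xs Xs) [IsMarkovKernel P]
    (π : Measure Xs) [IsProbabilityMeasure π]
    (hinv : ∀ A : Set Xs, MeasurableSet A → π A = ∫⁻ x, P x A ∂π)
    (r : Xs → ℝ) (hr : Measurable r) (hr01 : ∀ x, r x ∈ Set.Icc (0:ℝ) 1)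
    (V : Xs → ℝ) (hVmeas : Measurable V) (hVL2 : Integrable (fun x => V x ^ 2) π)
    (hfix : ∀ x : Xs, r x + γ * ∫ y, V y ∂(P x) = V x)
    (Q : Xs → ℝ) (hQmeas : Measurable Q) (hQL2 : Integrable (fun x => Q x ^ 2) π) :
    ∫ x, (∫ y, (r x + γ * Q y - Q x) * (Q x - V x) ∂(P x)) ∂π
      ≤ -(1 - γ) * pnorm π (fun x => Q x - V x) ^ 2 := by
  obtain ⟨hγ0, hγ1⟩ := hγ
  have hP : P ∘ₘ π = π := by
    ext A hA
    rw [Measure.bind_apply hA P.aemeasurable, hinv A hA]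
  have mem_lp : ∀ (f : Xs → ℝ), Measurable f → ∀ (μ : Measure Xs),
      Integrable (fun x => f x ^ 2) μ → MemLp f 2 μ := fun f hf μ h =>
    (memLp_two_iff_integrable_sq hf.aestronglyMeasurable).2 h
  set D : Xs → ℝ := fun x => Q x - V x with hD
  have hDm : Measurable D := hQmeas.sub hVmeas
  have hD2 : Integrable (fun x => D x ^ 2) π :=
    ((mem_lp Q hQmeas π hQL2).sub (mem_lp V hVmeas π hVL2)).integrable_sq
  have hVP : ∀ᵐ x ∂π, Integrable (fun y => V y ^ 2) (P x) :=
    Measure.ae_integrable_of_integrable_comp (by rw [hP]; exact hVL2)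
  have hQP : ∀ᵐ x ∂π, Integrable (fun y => Q y ^ 2) (P x) :=
    Measure.ae_integrable_of_integrable_comp (by rw [hP]; exact hQL2)
  have hPD2 : Integrable (fun x => ∫ y, D y ^ 2 ∂(P x)) π := by
    have := Measure.integrable_integral_norm_of_integrable_comp (κ := P) (μ := π)
      (f := fun x => D x ^ 2) (by rw [hP]; exact hD2)
    simpa using this
  have hPD2eq : ∫ x, ∫ y, D y ^ 2 ∂(P x) ∂π = ∫ x, D x ^ 2 ∂π := by
    have hc : (P ∘ₖ Kernel.const Unit π) () = π := by
      rw [← Measure.comp_eq_comp_const_apply, hP]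
    have h := Kernel.integral_comp (η := P) (κ := Kernel.const Unit π) (a := ())
      (f := fun x => D x ^ 2) (by rw [hc]; exact hD2)
    rw [hc, Kernel.const_apply] at h
    exact h.symm
  have hPDm : StronglyMeasurable (fun x => ∫ y, D y ∂(P x)) :=
    hDm.stronglyMeasurable.integral_kernel
  have key : ∀ᵐ x ∂π, (∫ y, (r x + γ * Q y - Q x) * (Q x - V x) ∂(P x))
        = D x * (γ * (∫ y, D y ∂(P x)) - D x) ∧
      (∫ y, D y ∂(P x)) ^ 2 ≤ ∫ y, D y ^ 2 ∂(P x) := by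
    filter_upwards [hVP, hQP] with x hv hq
    have hvL := mem_lp V hVmeas _ hv
    have hqL := mem_lp Q hQmeas _ hq
    have hvI : Integrable V (P x) := hvL.integrable (by norm_num)
    have hqI : Integrable Q (P x) := hqL.integrable (by norm_num)
    have hdI : Integrable D (P x) := hqI.sub hvI
    have hd2 : Integrable (fun y => D y ^ 2) (P x) := (hqL.sub hvL).integrable_sq
    constructor
    · have e1 : ∫ y, D y ∂(P x) = ∫ y, Q y ∂(P x) - ∫ y, V y ∂(P x) :=
        integral_sub hqI hvI
      have e2 : ∫ y, (r x + γ * Q y - Q x) ∂(P x) = r x + γ * ∫ y, Q y ∂(P x) - Q x := by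
        have hi : Integrable (fun y => r x + γ * Q y) (P x) :=
          (integrable_const _).add (hqI.const_mul _)
        rw [integral_sub hi (integrable_const _),
          integral_add (integrable_const _) (hqI.const_mul _), integral_const_mul]
        simp
      rw [integral_mul_const, e2, e1]
      have := hfix x
      simp only [hD]
      linear_combination (Q x - V x) * this
    · set m := ∫ y, D y ∂(P x) with hm
      have h0 : 0 ≤ ∫ y, (D y - m) ^ 2 ∂(P x) := integral_nonneg fun y => sq_nonneg _
      have e : ∫ y, (D y - m) ^ 2 ∂(P x) = ∫ y, D y ^ 2 ∂(P x) - 2 * m * m + m ^ 2 := by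
        have : (fun y => (D y - m) ^ 2) = fun y => D y ^ 2 - 2 * m * D y + m ^ 2 := by
          ext y; ring
        have hi : Integrable (fun y => D y ^ 2 - 2 * m * D y) (P x) :=
          hd2.sub (hdI.const_mul _)
        rw [this, integral_add hi (integrable_const _),
          integral_sub hd2 (hdI.const_mul _), integral_const_mul]
        simp [← hm]
      nlinarith
  have hbI : Integrable (fun x => γ / 2 * (D x ^ 2 + ∫ y, D y ^ 2 ∂(P x)) - D x ^ 2) π :=
    ((hD2.add hPD2).const_mul _).sub hD2
  have hbI' : Integrable (fun x => γ / 2 * (D x ^ 2 + ∫ y, D y ^ 2 ∂(P x)) + D x ^ 2) π :=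
    ((hD2.add hPD2).const_mul _).add hD2
  have hI : Integrable (fun x => D x * (γ * (∫ y, D y ∂(P x)) - D x)) π := by
    refine hbI'.mono' ?_ ?_
    · exact (hDm.mul ((hPDm.measurable.const_mul γ).sub hDm)).aestronglyMeasurable
    · filter_upwards [key] with x hx
      have h2 := hx.2
      rw [Real.norm_eq_abs, abs_le]
      constructor
      · nlinarith [mul_nonneg hγ0.le (sq_nonneg (D x + ∫ y, D y ∂(P x))),
          mul_le_mul_of_nonneg_left h2 hγ0.le]
      · nlinarith [mul_nonneg hγ0.le (sq_nonneg (D x - ∫ y, D y ∂(P x))),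
          mul_le_mul_of_nonneg_left h2 hγ0.le, sq_nonneg (D x)]
  rw [integral_congr_ae (key.mono fun x hx => hx.1)]
  have hle : ∫ x, D x * (γ * (∫ y, D y ∂(P x)) - D x) ∂π
      ≤ ∫ x, (γ / 2 * (D x ^ 2 + ∫ y, D y ^ 2 ∂(P x)) - D x ^ 2) ∂π := by
    refine integral_mono_ae hI hbI ?_
    filter_upwards [key] with x hx
    nlinarith [mul_nonneg hγ0.le (sq_nonneg (D x - ∫ y, D y ∂(P x))),
      mul_le_mul_of_nonneg_left hx.2 hγ0.le]
  refine hle.trans (le_of_eq ?_)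
  have hi : Integrable (fun x => γ / 2 * (D x ^ 2 + ∫ y, D y ^ 2 ∂(P x))) π :=
    (hD2.add hPD2).const_mul _
  rw [integral_sub hi hD2, integral_const_mul,
    integral_add hD2 hPD2, hPD2eq, pnorm,
    Real.sq_sqrt (integral_nonneg fun x => sq_nonneg _)]
  ring

end
end

section
/- Fix W(0) = (W_1(0),…,W_m(0)) ∈ (ℝ^d)^m, a ∈ {−1,+1}^m, W̃ ∈ (ℝ^d)^m, and x ∈ ℝ^d with ‖x‖₂ ≤ 1. Let S_x = { i ∈ {1,…,m} : 1{W̃_iᵀx ≥ 0} ≠ 1{W_i(0)ᵀx ≥ 0} }. Then |Q(x;W̃,a) − ∇_W Q(x;W(0),a)ᵀ W̃| ≤ (1/√m) Σ_{i∈S_x} ‖W̃_i − W_i(0)‖₂. Moreover, if max_{i≤m} ‖W̃_i − W_i(0)‖₂ ≤ λ/√m for some λ > 0, then |Q(x;W̃,a) − ∇_W Q(x;W(0),a)ᵀ W̃| ≤ (λ/m) · |{ i : |W_i(0)ᵀx| ≤ λ/√m }|. -/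
open MeasureTheory ProbabilityTheory Finset
open scoped ENNReal

noncomputable section

lemma dotp_diff_le {d : ℕ} (w v x : Fin d → ℝ) (hx : vnorm x ≤ 1) :
    |dotp w x - dotp v x| ≤ vnorm (fun j => w j - v j) := by
  have h1 : dotp w x - dotp v x = ∑ j, (w j - v j) * x j := by
    unfold dotp
    rw [← Finset.sum_sub_distrib]
    exact Finset.sum_congr rfl fun j _ => by ring
  have hn : 0 ≤ vnorm (fun j => w j - v j) := Real.sqrt_nonneg _
  have h2 : |∑ j, (w j - v j) * x j| ≤ vnorm (fun j => w j - v j) * vnorm x := by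
    unfold vnorm
    rw [← Real.sqrt_mul (Finset.sum_nonneg fun j _ => sq_nonneg _)]
    apply Real.abs_le_sqrt
    exact Finset.sum_mul_sq_le_sq_mul_sq _ _ _
  rw [h1]
  exact h2.trans (mul_le_of_le_one_right hn hx)

/-- Linearization error of the ReLU network at initialization. -/
theorem relu_linearization_error
    {d : ℕ} (m : ℕ) (hm : 1 ≤ m) (W0 Wt : ℕ → Fin d → ℝ) (a : ℕ → ℝ)
    (ha : ∀ i < m, a i = 1 ∨ a i = -1) (x : Fin d → ℝ) (hx : vnorm x ≤ 1) :
    |netQ m x Wt a - gradDot m x W0 Wt a|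
      ≤ (Real.sqrt m)⁻¹ * ∑ i ∈ Finset.range m,
          (if ¬ ((0 ≤ dotp (Wt i) x) ↔ (0 ≤ dotp (W0 i) x))
            then vnorm (fun j => Wt i j - W0 i j) else 0)
    ∧ ∀ lam : ℝ, 0 < lam →
        (∀ i < m, vnorm (fun j => Wt i j - W0 i j) ≤ lam / Real.sqrt m) →
        |netQ m x Wt a - gradDot m x W0 Wt a|
          ≤ lam / m * ∑ i ∈ Finset.range m,
              (if |dotp (W0 i) x| ≤ lam / Real.sqrt m then (1 : ℝ) else 0) := by
  have hs : (0 : ℝ) ≤ (Real.sqrt m)⁻¹ := inv_nonneg.mpr (Real.sqrt_nonneg _)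
  have key : |netQ m x Wt a - gradDot m x W0 Wt a|
      ≤ (Real.sqrt m)⁻¹ * ∑ i ∈ Finset.range m,
          (if ¬ ((0 ≤ dotp (Wt i) x) ↔ (0 ≤ dotp (W0 i) x))
            then vnorm (fun j => Wt i j - W0 i j) else 0) := by
    unfold netQ gradDot
    rw [← mul_sub, ← Finset.sum_sub_distrib, abs_mul, abs_of_nonneg hs]
    refine mul_le_mul_of_nonneg_left ?_ hs
    refine (Finset.abs_sum_le_sum_abs _ _).trans (Finset.sum_le_sum fun i hi => ?_)
    have hd := dotp_diff_le (Wt i) (W0 i) x hx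
    have haa : |a i| = 1 := by
      rcases ha i (Finset.mem_range.mp hi) with h | h <;> simp [h]
    rw [← mul_sub, abs_mul, haa, one_mul]
    generalize dotp (Wt i) x = p at *
    generalize dotp (W0 i) x = q at *
    have hd' := abs_le.mp hd
    by_cases hp : 0 ≤ p <;> by_cases hq : 0 ≤ q
    · simp [hp, hq]
    · simp only [hp, hq, max_eq_left hp, if_false, iff_false, not_true, not_false_iff, if_true]
      rw [abs_le]; constructor <;> linarith
    · simp only [hp, hq, max_eq_right (not_le.mp hp).le, iff_true, not_false_iff, if_true]
      rw [abs_le]; constructor <;> linarith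
    · simp [hp, hq, (not_le.mp hp).le]
  refine ⟨key, fun lam hlam hball => key.trans ?_⟩
  have hlm : lam / m = (Real.sqrt m)⁻¹ * (lam / Real.sqrt m) := by
    have : (m : ℝ) = Real.sqrt m * Real.sqrt m := (Real.mul_self_sqrt (Nat.cast_nonneg m)).symm
    conv_lhs => rw [this]
    rw [div_mul_eq_div_div, div_eq_inv_mul]
  rw [hlm, mul_assoc]
  refine mul_le_mul_of_nonneg_left ?_ hs
  rw [Finset.mul_sum]
  refine Finset.sum_le_sum fun i hi => ?_
  have hb := hball i (Finset.mem_range.mp hi)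
  have hd := abs_le.mp ((dotp_diff_le (Wt i) (W0 i) x hx).trans hb)
  have hr : 0 ≤ lam / Real.sqrt m := div_nonneg hlam.le (Real.sqrt_nonneg _)
  split_ifs with h1 h2 h2
  · linarith
  · simp
  · linarith
  · exfalso
    apply h2
    rw [abs_le]
    by_cases hp : 0 ≤ dotp (Wt i) x <;> by_cases hq : 0 ≤ dotp (W0 i) x
    · exact absurd (iff_of_true hp hq) h1
    · constructor <;> linarith
    · constructor <;> linarith
    · exact absurd (iff_of_false hp hq) h1

end
end

section
/- Fix W(0), W ∈ (ℝ^d)^m, a ∈ {−1,+1}^m, x ∈ ℝ^d with ‖x‖₂ ≤ 1, and a measurable v : ℝ^d → ℝ^d with sup_w ‖v(w)‖₂ ≤ ν̄. Let Ū = (a_i v(W_i(0))/√m)_{i=1}^m and S_x = { i : 1{W_iᵀx ≥ 0} ≠ 1{W_i(0)ᵀx ≥ 0} }. Then |(∇_W Q(x;W(0),a) − ∇_W Q(x;W,a))ᵀ Ū| ≤ (ν̄/m) |S_x|; moreover, if max_{i≤m} ‖W_i − W_i(0)‖₂ ≤ λ/√m for some λ > 0, then S_x ⊆ { i : |W_i(0)ᵀx|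 ≤ λ/√m } and hence |(∇_W Q(x;W(0),a) − ∇_W Q(x;W,a))ᵀ Ū| ≤ (ν̄/m) · |{ i : |W_i(0)ᵀx| ≤ λ/√m }|. -/
open MeasureTheory ProbabilityTheory Finset
open scoped ENNReal

noncomputable section

lemma abs_dotp_le {d : ℕ} (w x : Fin d → ℝ) : |dotp w x| ≤ vnorm w * vnorm x := by
  unfold dotp vnorm
  rw [← Real.sqrt_mul (Finset.sum_nonneg fun _ _ => sq_nonneg _)]
  exact Real.abs_le_sqrt (Finset.sum_mul_sq_le_sq_mul_sq _ _ _)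

lemma abs_dotp_le_of {d : ℕ} (w x : Fin d → ℝ) (hx : vnorm x ≤ 1) {c : ℝ}
    (hw : vnorm w ≤ c) : |dotp w x| ≤ c := by
  have h0 : 0 ≤ vnorm w := Real.sqrt_nonneg _
  calc |dotp w x| ≤ vnorm w * vnorm x := abs_dotp_le w x
    _ ≤ vnorm w * 1 := mul_le_mul_of_nonneg_left hx h0
    _ ≤ c := by simpa using hw

/-- Gradient-difference pairing with `Ū`, and inclusion of the sign-change set. -/
theorem grad_diff_pairing_Ubar
    {d : ℕ} (m : ℕ) (hm : 1 ≤ m) {ν : ℝ} (hν : 0 < ν)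
    (W0 W : ℕ → Fin d → ℝ) (a : ℕ → ℝ) (ha : ∀ i < m, a i = 1 ∨ a i = -1)
    (x : Fin d → ℝ) (hx : vnorm x ≤ 1)
    (v : (Fin d → ℝ) → Fin d → ℝ) (hvb : ∀ w, vnorm (v w) ≤ ν) :
    |gradDot m x W0 (fun i j => a i * v (W0 i) j / Real.sqrt m) a
      - gradDot m x W (fun i j => a i * v (W0 i) j / Real.sqrt m) a|
      ≤ ν / m * ∑ i ∈ Finset.range m,
          (if ¬ ((0 ≤ dotp (W i) x) ↔ (0 ≤ dotp (W0 i) x)) then (1 : ℝ) else 0)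
    ∧ ∀ lam : ℝ, 0 < lam →
        (∀ i < m, vnorm (fun j => W i j - W0 i j) ≤ lam / Real.sqrt m) →
        (∀ i < m, ¬ ((0 ≤ dotp (W i) x) ↔ (0 ≤ dotp (W0 i) x)) →
            |dotp (W0 i) x| ≤ lam / Real.sqrt m)
        ∧ |gradDot m x W0 (fun i j => a i * v (W0 i) j / Real.sqrt m) a
            - gradDot m x W (fun i j => a i * v (W0 i) j / Real.sqrt m) a|
            ≤ ν / m * ∑ i ∈ Finset.range m,
                (if |dotp (W0 i) x| ≤ lam / Real.sqrt m then (1 : ℝ) else 0) := by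
  have hm0 : (0 : ℝ) < m := by exact_mod_cast hm
  have key : |gradDot m x W0 (fun i j => a i * v (W0 i) j / Real.sqrt m) a
      - gradDot m x W (fun i j => a i * v (W0 i) j / Real.sqrt m) a|
      ≤ ν / m * ∑ i ∈ Finset.range m,
          (if ¬ ((0 ≤ dotp (W i) x) ↔ (0 ≤ dotp (W0 i) x)) then (1 : ℝ) else 0) := by
    unfold gradDot
    rw [← mul_sub, ← Finset.sum_sub_distrib, Finset.mul_sum, Finset.mul_sum]
    refine (Finset.abs_sum_le_sum_abs _ _).trans (Finset.sum_le_sum fun i hi => ?_)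
    have hU : dotp (fun j => a i * v (W0 i) j / Real.sqrt m) x
        = a i * (Real.sqrt m)⁻¹ * dotp (v (W0 i)) x := by
      unfold dotp
      rw [Finset.mul_sum]
      exact Finset.sum_congr rfl fun j _ => by ring
    have hb : |dotp (v (W0 i)) x| ≤ ν := abs_dotp_le_of _ _ hx (hvb _)
    have haa : a i * a i = 1 := by
      rcases ha i (Finset.mem_range.mp hi) with h | h <;> rw [h] <;> norm_num
    have hss : (Real.sqrt m)⁻¹ * (Real.sqrt m)⁻¹ = (m : ℝ)⁻¹ := by
      rw [← mul_inv, Real.mul_self_sqrt hm0.le]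
    have hT : (Real.sqrt m)⁻¹ * (a i * (a i * (Real.sqrt m)⁻¹ * dotp (v (W0 i)) x))
        = (m : ℝ)⁻¹ * dotp (v (W0 i)) x := by
      rw [← hss]
      linear_combination (Real.sqrt m)⁻¹ * (Real.sqrt m)⁻¹ * dotp (v (W0 i)) x * haa
    have hB : |(m : ℝ)⁻¹ * dotp (v (W0 i)) x| ≤ ν / m := by
      rw [abs_mul, abs_of_pos (inv_pos.mpr hm0), div_eq_inv_mul]
      exact mul_le_mul_of_nonneg_left hb (inv_pos.mpr hm0).le
    rw [hU]
    by_cases h1 : 0 ≤ dotp (W i) x <;> by_cases h0 : 0 ≤ dotp (W0 i) x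
    · simp [h1, h0]
    · simp only [h1, h0, if_true, if_false, mul_zero, zero_sub, mul_neg, abs_neg, hT]
      simpa using hB
    · simp only [h1, h0, if_true, if_false, mul_zero, sub_zero, hT]
      simpa using hB
    · simp [h1, h0]
  refine ⟨key, fun lam _ hW => ?_⟩
  have incl : ∀ i < m, ¬ ((0 ≤ dotp (W i) x) ↔ (0 ≤ dotp (W0 i) x)) →
      |dotp (W0 i) x| ≤ lam / Real.sqrt m := by
    intro i hi hne
    have h := abs_dotp_le_of _ _ hx (hW i hi)
    have hd : dotp (fun j => W i j - W0 i j) x = dotp (W i) x - dotp (W0 i) x := by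
      unfold dotp
      rw [← Finset.sum_sub_distrib]
      exact Finset.sum_congr rfl fun j _ => by ring
    rw [hd] at h
    obtain ⟨ha1, ha2⟩ := abs_le.mp h
    rw [abs_le]
    by_cases h1 : 0 ≤ dotp (W i) x <;> by_cases h0 : 0 ≤ dotp (W0 i) x
    · exact absurd (iff_of_true h1 h0) hne
    · constructor <;> linarith
    · constructor <;> linarith
    · exact absurd (iff_of_false h1 h0) hne
  refine ⟨incl, key.trans (mul_le_mul_of_nonneg_left (Finset.sum_le_sum fun i hi => ?_)
    (div_pos hν hm0).le)⟩
  have := incl i (Finset.mem_range.mp hi)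
  split_ifs with h1 h2 h2
  · exact zero_le_one
  · exact le_refl (0 : ℝ)
  · exact le_refl (1 : ℝ)
  · exact absurd (this h1) h2

end
end

section
/- Fix m ≥ 1, a ∈ {−1,+1}^m, γ ∈ (0,1), and x, x′ ∈ ℝ^d with ‖x‖₂ ≤ 1, ‖x′‖₂ ≤ 1. (i) For any W, W′ ∈ (ℝ^d)^m: |Q(x;W,a) − Q(x;W′,a)| ≤ ‖W − W′‖₂, where ‖·‖₂ on (ℝ^d)^m is the Euclidean norm of the concatenation. (ii) Consequently, if W(0) ∈ (ℝ^d)^m satisfies Q(y;W(0),a) = 0 for all y with ‖y‖₂ ≤ 1, then for any W ∈ (ℝ^d)^m and any ρ ∈ [0,1]: ‖(ρ + γ Q(x′;W,a) − Q(x;W,a)) · ∇_W Q(x;W,a)‖₂ ≤ 1 + 2‖W − W(0)‖₂. (Semi-gradient norm bound, inequality (24).) -/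
open MeasureTheory ProbabilityTheory Finset
open scoped ENNReal

noncomputable section

theorem sum_sq_le_one_of_vnorm {d : ℕ} {x : Fin d → ℝ} (hx : vnorm x ≤ 1) :
    ∑ j, x j ^ 2 ≤ 1 := by
  unfold vnorm at hx
  simpa using (Real.sqrt_le_left zero_le_one).1 hx

theorem netQ_lip {d : ℕ} (m : ℕ) (hm : 1 ≤ m)
    (a : ℕ → ℝ) (ha : ∀ i < m, a i = 1 ∨ a i = -1)
    (x : Fin d → ℝ) (hx : vnorm x ≤ 1) (W W' : ℕ → Fin d → ℝ) :
    |netQ m x W a - netQ m x W' a| ≤ Real.sqrt (diffSq m W W') := by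
  have hx2 := sum_sq_le_one_of_vnorm hx
  apply Real.abs_le_sqrt
  have hm0 : (0:ℝ) < m := by exact_mod_cast hm
  have e : netQ m x W a - netQ m x W' a = (Real.sqrt m)⁻¹ *
      ∑ i ∈ Finset.range m, a i * (max (dotp (W i) x) 0 - max (dotp (W' i) x) 0) := by
    simp only [netQ, mul_sub, Finset.sum_sub_distrib]
  have h1 := sq_sum_le_card_mul_sum_sq (s := Finset.range m)
    (f := fun i => a i * (max (dotp (W i) x) 0 - max (dotp (W' i) x) 0))
  rw [Finset.card_range] at h1
  rw [e, mul_pow, inv_pow, Real.sq_sqrt hm0.le, inv_mul_le_iff₀ hm0]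
  refine h1.trans (mul_le_mul_of_nonneg_left ?_ hm0.le)
  unfold diffSq
  refine Finset.sum_le_sum fun i hi => ?_
  have ha2 : a i ^ 2 = 1 := by
    rcases ha i (Finset.mem_range.1 hi) with h | h <;> rw [h] <;> norm_num
  rw [mul_pow, ha2, one_mul]
  have h2 : (max (dotp (W i) x) 0 - max (dotp (W' i) x) 0) ^ 2
      ≤ (dotp (W i) x - dotp (W' i) x) ^ 2 :=
    sq_le_sq.2 (abs_max_sub_max_le_abs _ _ _)
  have h3 : dotp (W i) x - dotp (W' i) x = ∑ j, (W i j - W' i j) * x j := by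
    simp only [dotp, sub_mul, Finset.sum_sub_distrib]
  refine h2.trans ?_
  rw [h3]
  refine (Finset.sum_mul_sq_le_sq_mul_sq _ _ _).trans ?_
  exact mul_le_of_le_one_right (Finset.sum_nonneg fun j _ => sq_nonneg _) hx2

/-- Lipschitzness in `W` and the semi-gradient norm bound (inequality (24)). -/
theorem semigradient_norm_bound
    {d : ℕ} (m : ℕ) (hm : 1 ≤ m) {γ : ℝ} (hγ : γ ∈ Set.Ioo (0:ℝ) 1)
    (a : ℕ → ℝ) (ha : ∀ i < m, a i = 1 ∨ a i = -1)
    (x x' : Fin d → ℝ) (hx : vnorm x ≤ 1) (hx' : vnorm x' ≤ 1) :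
    (∀ W W' : ℕ → Fin d → ℝ,
      |netQ m x W a - netQ m x W' a| ≤ Real.sqrt (diffSq m W W'))
    ∧ ∀ W0 : ℕ → Fin d → ℝ,
        (∀ y : Fin d → ℝ, vnorm y ≤ 1 → netQ m y W0 a = 0) →
        ∀ (W : ℕ → Fin d → ℝ) (ρ : ℝ), ρ ∈ Set.Icc (0:ℝ) 1 →
          Real.sqrt (∑ i ∈ Finset.range m, ∑ j,
              ((ρ + γ * netQ m x' W a - netQ m x W a)
                * ((Real.sqrt m)⁻¹ * a i * (if 0 ≤ dotp (W i) x then x j else 0))) ^ 2)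
            ≤ 1 + 2 * Real.sqrt (diffSq m W W0) := by
  refine ⟨fun W W' => netQ_lip m hm a ha x hx W W', ?_⟩
  intro W0 h0 W ρ hρ
  have b1 := netQ_lip m hm a ha x hx W W0
  have b2 := netQ_lip m hm a ha x' hx' W W0
  rw [h0 x hx, sub_zero] at b1
  rw [h0 x' hx', sub_zero] at b2
  have hx2 := sum_sq_le_one_of_vnorm hx
  have hm0 : (0:ℝ) < m := by exact_mod_cast hm
  set D := Real.sqrt (diffSq m W W0) with hD
  have hD0 : 0 ≤ D := Real.sqrt_nonneg _
  set c := ρ + γ * netQ m x' W a - netQ m x W a with hc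
  have hcb : |c| ≤ 1 + 2 * D := by
    have h3 : |γ * netQ m x' W a| ≤ D := by
      rw [abs_mul, abs_of_pos hγ.1]
      exact (mul_le_of_le_one_left (abs_nonneg _) hγ.2.le).trans b2
    obtain ⟨p1, p2⟩ := abs_le.1 h3
    obtain ⟨q1, q2⟩ := abs_le.1 b1
    obtain ⟨r1, r2⟩ := hρ
    rw [abs_le]
    constructor <;> linarith
  refine le_trans ?_ hcb
  rw [← Real.sqrt_sq_eq_abs]
  apply Real.sqrt_le_sqrt
  have key : ∀ i ∈ Finset.range m, ∑ j,
      (c * ((Real.sqrt m)⁻¹ * a i * (if 0 ≤ dotp (W i) x then x j else 0))) ^ 2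
      ≤ c ^ 2 * (m : ℝ)⁻¹ := by
    intro i hi
    have ha2 : a i ^ 2 = 1 := by
      rcases ha i (Finset.mem_range.1 hi) with h | h <;> rw [h] <;> norm_num
    have hcm : 0 ≤ c ^ 2 * (m : ℝ)⁻¹ := by positivity
    calc _ ≤ ∑ j, c ^ 2 * (m : ℝ)⁻¹ * x j ^ 2 := by
          refine Finset.sum_le_sum fun j _ => ?_
          rw [mul_pow, mul_pow, mul_pow, ha2, inv_pow, Real.sq_sqrt hm0.le, mul_one, ← mul_assoc]
          refine mul_le_mul_of_nonneg_left ?_ hcm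
          split_ifs
          · exact le_rfl
          · simpa using sq_nonneg (x j)
      _ ≤ _ := by
          rw [← Finset.mul_sum]
          exact mul_le_of_le_one_right hcm hx2
  refine (Finset.sum_le_sum key).trans ?_
  rw [Finset.sum_const, Finset.card_range, nsmul_eq_mul]
  apply le_of_eq
  field_simp

end
end
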